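/- arXiv:math/0603367 — 3 statements merged into one kernel-verified Lean document; each statement's English description precedes it below -/
import Mathlib

section
/- For every ψ = (ψ^1, ψ^2, ψ^3, ψ^4) ∈ ℂ⁴, the Minkowski square of the Dirac current satisfies the identity g(J,J) := (J^0(ψ))² − (J^1(ψ))² − (J^2(ψ))² − (J^3(ψ))² = 4c²( ψ^1·conj(ψ^1)·ψ^3·conj(ψ^3) + ψ^2·conj(ψ^2)·ψ^4·conj(ψ^4) + ψ^1·conj(ψ^2)·ψ^4·conj(ψ^3) + ψ^2·conj(ψ^1)·ψ^3·conj(ψ^4) ). -/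
open Matrix Complex

/-- The Dirac form `D`. -/
noncomputable def diracD : Matrix (Fin 4) (Fin 4) ℂ :=
  !![0, 0, 1, 0;
     0, 0, 0, 1;
     1, 0, 0, 0;
     0, 1, 0, 0]

/-- The standard Dirac matrices `γ^0, γ^1, γ^2, γ^3`. -/
noncomputable def diracGamma : Fin 4 → Matrix (Fin 4) (Fin 4) ℂ
  | 0 => !![0, 0, 1, 0;
            0, 0, 0, 1;
            1, 0, 0, 0;
            0, 1, 0, 0]
  | 1 => !![0, 0, 0, -1;
            0, 0, -1, 0;
            0, 1, 0, 0;
            1, 0, 0, 0]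
  | 2 => !![0, 0, 0, I;
            0, 0, -I, 0;
            0, -I, 0, 0;
            I, 0, 0, 0]
  | 3 => !![0, 0, -1, 0;
            0, 0, 0, 1;
            1, 0, 0, 0;
            0, -1, 0, 0]

/-- The Dirac current component `J^q(ψ) = c · ψ† D γ^q ψ`. -/
noncomputable def diracJ (c : ℝ) (q : Fin 4) (ψ : Fin 4 → ℂ) : ℂ :=
  (c : ℂ) * (star ψ ⬝ᵥ (diracD * diracGamma q) *ᵥ ψ)

/-- The Minkowski square of the Dirac current, formula (1.18). -/
theorem dirac_current_minkowski_square (c : ℝ) (hc : 0 < c) (ψ : Fin 4 → ℂ) :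
    (diracJ c 0 ψ) ^ 2 - (diracJ c 1 ψ) ^ 2 - (diracJ c 2 ψ) ^ 2 - (diracJ c 3 ψ) ^ 2
    = 4 * (c : ℂ) ^ 2 *
        (ψ 0 * (starRingEnd ℂ) (ψ 0) * ψ 2 * (starRingEnd ℂ) (ψ 2)
          + ψ 1 * (starRingEnd ℂ) (ψ 1) * ψ 3 * (starRingEnd ℂ) (ψ 3)
          + ψ 0 * (starRingEnd ℂ) (ψ 1) * ψ 3 * (starRingEnd ℂ) (ψ 2)
          + ψ 1 * (starRingEnd ℂ) (ψ 0) * ψ 2 * (starRingEnd ℂ) (ψ 3)) := by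
  simp only [diracJ, diracD, diracGamma, dotProduct, mulVec, mul_apply, Fin.sum_univ_four,
    Pi.star_apply, RCLike.star_def]
  simp
  ring_nf
  simp only [I_sq]
  ring
end

section
/- (Theorem 1.3, pointwise form in a canonically orthonormal frame.) For every ψ ∈ ℂ⁴, the Dirac current J(ψ) = (J^0(ψ), J^1(ψ), J^2(ψ), J^3(ψ)) is a causal vector directed to the Future: (J^0(ψ))² − (J^1(ψ))² − (J^2(ψ))² − (J^3(ψ))² ≥ 0 and J^0(ψ) ≥ 0. -/
open Matrix Complex

lemma diracJ_zero_re (c : ℝ) (ψ : Fin 4 → ℂ) :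
    (diracJ c 0 ψ).re = c * (normSq (ψ 0) + normSq (ψ 1) + normSq (ψ 2) + normSq (ψ 3)) := by
  simp [diracJ, diracD, diracGamma, Matrix.mulVec, dotProduct, Fin.sum_univ_four, normSq_apply]

/-- The Minkowski square of the Dirac current is `4 c²` times the squared modulus of the Hermitian
product of the two chiral halves of `ψ`. -/
lemma diracJ_minkowski_sq (c : ℝ) (ψ : Fin 4 → ℂ) :
    (diracJ c 0 ψ).re ^ 2 - (diracJ c 1 ψ).re ^ 2
        - (diracJ c 2 ψ).re ^ 2 - (diracJ c 3 ψ).re ^ 2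
      = 4 * c ^ 2 * normSq (star (ψ 0) * ψ 2 + star (ψ 1) * ψ 3) := by
  simp [diracJ, diracD, diracGamma, Matrix.mulVec, dotProduct, Fin.sum_univ_four, normSq_apply]
  ring

/-- Theorem 1.3 (pointwise form): the Dirac current is a causal vector
directed to the Future. -/
theorem dirac_current_causal_future (c : ℝ) (hc : 0 < c) (ψ : Fin 4 → ℂ) :
    0 ≤ (diracJ c 0 ψ).re ^ 2 - (diracJ c 1 ψ).re ^ 2
        - (diracJ c 2 ψ).re ^ 2 - (diracJ c 3 ψ).re ^ 2
    ∧ 0 ≤ (diracJ c 0 ψ).re := by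
  rw [diracJ_minkowski_sq, diracJ_zero_re]
  have h := fun z => normSq_nonneg z
  exact ⟨mul_nonneg (by positivity) (h _),
    mul_nonneg hc.le (by linarith [h (ψ 0), h (ψ 1), h (ψ 2), h (ψ 3)])⟩
end

section
/- If two differentiable functions φ, ψ : ℝ⁴ → ℂ⁴ both satisfy the flat-space Dirac equation (with the same constants ħ, m, c), then the two-state current J^q(φ,ψ)(x) = c · φ(x)† D γ^q ψ(x) is divergence-free: ∑_{q=0}^{3} ∂_q J^q(φ,ψ)(x) = 0 for all x ∈ ℝ⁴. -/
open Matrix Complex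

/-- A differentiable `ψ : ℝ⁴ → ℂ⁴` satisfies the flat-space Dirac equation if
`iħ ∑ q, γ^q ∂_q ψ = m c ψ`. -/
def SatisfiesDiracEq (hbar c m : ℝ) (ψ : (Fin 4 → ℝ) → Fin 4 → ℂ) : Prop :=
  ∀ x : Fin 4 → ℝ,
    (Complex.I * (hbar : ℂ)) •
        ∑ q : Fin 4, diracGamma q *ᵥ (fderiv ℝ ψ x (Pi.single q 1))
      = ((m * c : ℝ) : ℂ) • ψ x

/-- The product rule for a sesquilinear pairing of two vector-valued functions. -/
theorem fderiv_star_dotProduct_mulVec {E n : Type*} [NormedAddCommGroup E] [NormedSpace ℝ E]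
    [Fintype n] (M : Matrix n n ℂ) {φ ψ : E → n → ℂ} {x : E}
    (hφ : DifferentiableAt ℝ φ x) (hψ : DifferentiableAt ℝ ψ x) (c : ℂ) (v : E) :
    fderiv ℝ (fun y => c * (star (φ y) ⬝ᵥ M *ᵥ ψ y)) x v =
      c * (star (fderiv ℝ φ x v) ⬝ᵥ M *ᵥ ψ x + star (φ x) ⬝ᵥ M *ᵥ fderiv ℝ ψ x v) := by
  have hφi := hasFDerivAt_pi'.1 hφ.hasFDerivAt
  have hψi := hasFDerivAt_pi'.1 hψ.hasFDerivAt
  have h : HasFDerivAt (fun y => c * ∑ i, star (φ y i) * ∑ j, M i j * ψ y j) _ x :=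
    (HasFDerivAt.fun_sum (u := Finset.univ) fun i _ => (hφi i).star.mul
      (HasFDerivAt.fun_sum (u := Finset.univ) fun j _ => (hψi j).const_mul (M i j))).const_mul c
  have h' := congrArg (fun L => L v) h.fderiv
  simp only [dotProduct, mulVec, Pi.star_apply]
  refine h'.trans ?_
  simp [Finset.sum_add_distrib, mul_add, mul_comm, add_comm]

/-- The matrices `D γ^q` are Hermitian. -/
theorem conjTranspose_diracD_mul_diracGamma (q : Fin 4) :
    (diracD * diracGamma q)ᴴ = diracD * diracGamma q := by
  ext i j
  fin_cases q <;> fin_cases i <;> fin_cases j <;>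
    simp [diracD, diracGamma, Matrix.mul_apply, Fin.sum_univ_four]

/-- The Dirac form is Hermitian. -/
theorem conjTranspose_diracD : diracDᴴ = diracD := by
  ext i j
  fin_cases i <;> fin_cases j <;> simp [diracD]

/-- The two-state current `J^q(φ,ψ) = c · φ† D γ^q ψ` of two solutions of the
flat-space Dirac equation is divergence-free. -/
theorem dirac_two_state_current_div_free (hbar c m : ℝ) (hhbar : 0 < hbar) (hc : 0 < c)
    (hm : 0 < m) (φ ψ : (Fin 4 → ℝ) → Fin 4 → ℂ)
    (hφ : Differentiable ℝ φ) (hψ : Differentiable ℝ ψ)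
    (hdiracφ : SatisfiesDiracEq hbar c m φ) (hdiracψ : SatisfiesDiracEq hbar c m ψ) :
    ∀ x : Fin 4 → ℝ,
      ∑ q : Fin 4,
        fderiv ℝ (fun y => (c : ℂ) * (star (φ y) ⬝ᵥ (diracD * diracGamma q) *ᵥ ψ y)) x
          (Pi.single q 1) = 0 := by
  intro x
  have solve : ∀ χ : (Fin 4 → ℝ) → Fin 4 → ℂ, SatisfiesDiracEq hbar c m χ →
      ∑ q, diracGamma q *ᵥ fderiv ℝ χ x (Pi.single q 1) =
        (-(I * ((m * c / hbar : ℝ) : ℂ))) • χ x := by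
    intro χ hχ
    have hb : (hbar : ℂ) ≠ 0 := by exact_mod_cast hhbar.ne'
    have hk : -(I * ((m * c / hbar : ℝ) : ℂ)) =
        (I * (hbar : ℂ))⁻¹ * ((m * c : ℝ) : ℂ) := by
      rw [mul_inv, Complex.inv_I]
      push_cast
      ring
    rw [hk, mul_smul, ← hχ x, inv_smul_smul₀ (mul_ne_zero I_ne_zero hb)]
  have move : ∀ (M : Matrix (Fin 4) (Fin 4) ℂ) (_ : Mᴴ = M) (a b : Fin 4 → ℂ),
      star a ⬝ᵥ M *ᵥ b = star (M *ᵥ a) ⬝ᵥ b := by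
    intro M hM a b
    rw [star_mulVec, hM, dotProduct_mulVec]
  simp_rw [fderiv_star_dotProduct_mulVec _ (hφ x) (hψ x)]
  rw [← Finset.mul_sum, Finset.sum_add_distrib]
  simp_rw [move _ (conjTranspose_diracD_mul_diracGamma _) (fderiv ℝ φ x _)]
  simp_rw [← mulVec_mulVec]
  rw [← sum_dotProduct, ← dotProduct_sum, ← star_sum, ← mulVec_sum, ← mulVec_sum,
    solve φ hdiracφ, solve ψ hdiracψ, ← move _ conjTranspose_diracD]
  simp [mulVec_smul, mulVec_neg]
end
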